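/- Let S and A be finite nonempty sets, let π be a policy, let T and T⁰ be transition kernels with D_TV(T(·|s,a), T⁰(·|s,a)) ≤ ρ' for every (s,a), let γ ∈ (0,1), and let μ be an initial distribution on S. Let f : [0,∞) → ℝ satisfy f(1) = 0 and f(t) ≤ α · (1/2)|t − 1| for all t ≥ 0, with α ≥ 0. If the triplet occupancy d^π_T is absolutely continuous with respect to d^π_{T⁰}, then D_f( d^π_T(·,·,·) ‖ d^π_{T⁰}(·,·,·) ) ≤ α ρ'/(1−γ). -/

import Mathlib

open Matrix

/-- Total variation distance between two (finitely supported) distributions: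
`D_TV(p,q) = (1/2) ∑ₓ |p x − q x|`. -/
noncomputable def tvDist {X : Type*} [Fintype X] (p q : X → ℝ) : ℝ :=
  (1 / 2) * ∑ x, |p x - q x|

/-- The state-transition matrix `P(s,s') = ∑ₐ π(a|s) T(s'|s,a)` induced by a
policy `π` and a transition kernel `T`. -/
noncomputable def policyMatrix {S A : Type*} [Fintype S] [Fintype A]
    (π : S → A → ℝ) (T : S → A → S → ℝ) : Matrix S S ℝ :=
  Matrix.of fun s s' => ∑ a, π s a * T s a s'

/-- The discounted state occupancy measure
`d^π_T(s) = (1−γ) ∑_{t≥0} γ^t (μᵀ Pᵗ)(s)`. -/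
noncomputable def stateOcc {S A : Type*} [Fintype S] [DecidableEq S] [Fintype A]
    (π : S → A → ℝ) (T : S → A → S → ℝ) (γ : ℝ) (μ : S → ℝ) (s : S) : ℝ :=
  (1 - γ) * ∑' t : ℕ, γ ^ t * Matrix.vecMul μ (policyMatrix π T ^ t) s


/-- The discounted triplet occupancy measure
`d^π_T(s,a,s') = π(a|s) d^π_T(s) T(s'|s,a)`. -/
noncomputable def tripletOcc {S A : Type*} [Fintype S] [DecidableEq S] [Fintype A]
    (π : S → A → ℝ) (T : S → A → S → ℝ) (γ : ℝ) (μ : S → ℝ)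
    (x : S × A × S) : ℝ :=
  π x.1 x.2.1 * stateOcc π T γ μ x.1 * T x.1 x.2.1 x.2.2

open scoped Classical in
/-- The `f`-divergence `D_f(P‖Q) = ∑_{x : Q(x) > 0} Q(x) f(P(x)/Q(x))`
between finitely supported distributions. -/
noncomputable def fDiv {X : Type*} [Fintype X] (f : ℝ → ℝ) (P Q : X → ℝ) : ℝ :=
  ∑ x, if 0 < Q x then Q x * f (P x / Q x) else 0

section Occupancy

variable {S A : Type*} [Fintype S] [Fintype A]

/-- Summing over the actions and successors of a stochastic policy and kernel has no effect. -/
lemma sum_policy_mul_kernel {π : S → A → ℝ} (hπ : ∀ s, ∑ a, π s a = 1)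
    {T : S → A → S → ℝ} (hT : ∀ s a, ∑ s', T s a s' = 1) (v : S → ℝ) :
    ∑ s, ∑ a, ∑ s', π s a * v s * T s a s' = ∑ s, v s := by
  refine Finset.sum_congr rfl fun s _ => ?_
  simp_rw [← Finset.mul_sum, hT, mul_one, ← Finset.sum_mul, hπ, one_mul]

lemma vecMul_policyMatrix (π : S → A → ℝ) (T : S → A → S → ℝ) (v : S → ℝ) (s' : S) :
    vecMul v (policyMatrix π T) s' = ∑ s, ∑ a, π s a * v s * T s a s' := by
  simp only [vecMul, dotProduct, policyMatrix, of_apply, Finset.mul_sum]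
  exact Finset.sum_congr rfl fun s _ => Finset.sum_congr rfl fun a _ => by ring

lemma sum_vecMul_policyMatrix {π : S → A → ℝ} (hπ : ∀ s, ∑ a, π s a = 1)
    {T : S → A → S → ℝ} (hT : ∀ s a, ∑ s', T s a s' = 1) (v : S → ℝ) :
    ∑ s, vecMul v (policyMatrix π T) s = ∑ s, v s := by
  simp_rw [vecMul_policyMatrix]
  rw [Finset.sum_comm, ← sum_policy_mul_kernel hπ hT v]
  exact Finset.sum_congr rfl fun s _ => Finset.sum_comm

variable [DecidableEq S]

lemma vecMul_policyMatrix_pow_nonneg {π : S → A → ℝ} (hπ0 : ∀ s a, 0 ≤ π s a)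
    {T : S → A → S → ℝ} (hT0 : ∀ s a s', 0 ≤ T s a s') {μ : S → ℝ} (hμ0 : ∀ s, 0 ≤ μ s)
    (t : ℕ) (s : S) : 0 ≤ vecMul μ (policyMatrix π T ^ t) s := by
  induction t generalizing s with
  | zero => simpa using hμ0 s
  | succ t ih =>
    rw [pow_succ, ← vecMul_vecMul, vecMul_policyMatrix]
    exact Finset.sum_nonneg fun s _ => Finset.sum_nonneg fun a _ =>
      mul_nonneg (mul_nonneg (hπ0 _ _) (ih _)) (hT0 _ _ _)

lemma sum_vecMul_policyMatrix_pow {π : S → A → ℝ} (hπ : ∀ s, ∑ a, π s a = 1)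
    {T : S → A → S → ℝ} (hT : ∀ s a, ∑ s', T s a s' = 1) (μ : S → ℝ) (t : ℕ) :
    ∑ s, vecMul μ (policyMatrix π T ^ t) s = ∑ s, μ s := by
  induction t with
  | zero => simp
  | succ t ih => rw [pow_succ, ← vecMul_vecMul, sum_vecMul_policyMatrix hπ hT, ih]

lemma stateOcc_nonneg {π : S → A → ℝ} (hπ0 : ∀ s a, 0 ≤ π s a)
    {T : S → A → S → ℝ} (hT0 : ∀ s a s', 0 ≤ T s a s') {γ : ℝ} (hγ0 : 0 ≤ γ) (hγ1 : γ ≤ 1)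
    {μ : S → ℝ} (hμ0 : ∀ s, 0 ≤ μ s) (s : S) : 0 ≤ stateOcc π T γ μ s :=
  mul_nonneg (sub_nonneg.2 hγ1) <| tsum_nonneg fun t =>
    mul_nonneg (pow_nonneg hγ0 t) (vecMul_policyMatrix_pow_nonneg hπ0 hT0 hμ0 t s)

lemma summable_stateOcc {π : S → A → ℝ} (hπ0 : ∀ s a, 0 ≤ π s a)
    (hπ : ∀ s, ∑ a, π s a = 1) {T : S → A → S → ℝ} (hT0 : ∀ s a s', 0 ≤ T s a s')
    (hT : ∀ s a, ∑ s', T s a s' = 1) {γ : ℝ} (hγ0 : 0 ≤ γ) (hγ1 : γ < 1)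
    {μ : S → ℝ} (hμ0 : ∀ s, 0 ≤ μ s) (s : S) :
    Summable fun t : ℕ => γ ^ t * vecMul μ (policyMatrix π T ^ t) s := by
  have hnonneg := vecMul_policyMatrix_pow_nonneg hπ0 hT0 hμ0
  refine Summable.of_nonneg_of_le (fun t => mul_nonneg (pow_nonneg hγ0 t) (hnonneg t s))
    (fun t => mul_le_mul_of_nonneg_left ?_ (pow_nonneg hγ0 t))
    ((summable_geometric_of_lt_one hγ0 hγ1).mul_right (∑ s, μ s))
  rw [← sum_vecMul_policyMatrix_pow hπ hT μ t]
  exact Finset.single_le_sum (fun s _ => hnonneg t s) (Finset.mem_univ s)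

/-- The Bellman flow equation of the discounted state occupancy measure. -/
lemma stateOcc_eq_add {π : S → A → ℝ} (hπ0 : ∀ s a, 0 ≤ π s a)
    (hπ : ∀ s, ∑ a, π s a = 1) {T : S → A → S → ℝ} (hT0 : ∀ s a s', 0 ≤ T s a s')
    (hT : ∀ s a, ∑ s', T s a s' = 1) {γ : ℝ} (hγ0 : 0 ≤ γ) (hγ1 : γ < 1)
    {μ : S → ℝ} (hμ0 : ∀ s, 0 ≤ μ s) (s : S) :
    stateOcc π T γ μ s =
      (1 - γ) * μ s + γ * vecMul (stateOcc π T γ μ) (policyMatrix π T) s := by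
  have hsum := summable_stateOcc hπ0 hπ hT0 hT hγ0 hγ1 hμ0
  have hstep (t : ℕ) : γ ^ (t + 1) * vecMul μ (policyMatrix π T ^ (t + 1)) s =
      ∑ s', γ ^ t * vecMul μ (policyMatrix π T ^ t) s' * (γ * policyMatrix π T s' s) := by
    rw [pow_succ (policyMatrix π T), ← vecMul_vecMul, vecMul, dotProduct, Finset.mul_sum]
    exact Finset.sum_congr rfl fun s' _ => by ring
  rw [stateOcc, (hsum s).tsum_eq_zero_add]
  simp_rw [hstep]
  rw [Summable.tsum_finsetSum fun s' _ => (hsum s').mul_right _]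
  simp_rw [tsum_mul_right]
  have hvec : vecMul (stateOcc π T γ μ) (policyMatrix π T) s =
      ∑ s', stateOcc π T γ μ s' * policyMatrix π T s' s := rfl
  simp only [hvec, pow_zero, vecMul_one, one_mul, mul_add, stateOcc, Finset.mul_sum,
    add_right_inj]
  exact Finset.sum_congr rfl fun s' _ => by ring

lemma sum_stateOcc {π : S → A → ℝ} (hπ0 : ∀ s a, 0 ≤ π s a)
    (hπ : ∀ s, ∑ a, π s a = 1) {T : S → A → S → ℝ} (hT0 : ∀ s a s', 0 ≤ T s a s')
    (hT : ∀ s a, ∑ s', T s a s' = 1) {γ : ℝ} (hγ0 : 0 ≤ γ) (hγ1 : γ < 1)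
    {μ : S → ℝ} (hμ0 : ∀ s, 0 ≤ μ s) :
    ∑ s, stateOcc π T γ μ s = ∑ s, μ s := by
  have h := Finset.sum_congr (rfl : (Finset.univ : Finset S) = Finset.univ)
    fun s _ => stateOcc_eq_add hπ0 hπ hT0 hT hγ0 hγ1 hμ0 s
  rw [Finset.sum_add_distrib, ← Finset.mul_sum, ← Finset.mul_sum,
    sum_vecMul_policyMatrix hπ hT] at h
  exact mul_left_cancel₀ (sub_ne_zero.2 hγ1.ne') (by linarith)

/-- The total variation distance of triplet occupancies under kernels at distance at most `ρ`. -/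
lemma tvDist_tripletOcc_le {π : S → A → ℝ} (hπ0 : ∀ s a, 0 ≤ π s a)
    (hπ : ∀ s, ∑ a, π s a = 1) {T T' : S → A → S → ℝ}
    (hT0 : ∀ s a s', 0 ≤ T s a s') (hT : ∀ s a, ∑ s', T s a s' = 1)
    (hT0' : ∀ s a s', 0 ≤ T' s a s') (hT' : ∀ s a, ∑ s', T' s a s' = 1)
    {γ : ℝ} (hγ0 : 0 ≤ γ) (hγ1 : γ < 1)
    {μ : S → ℝ} (hμ0 : ∀ s, 0 ≤ μ s) (hμ : ∑ s, μ s = 1)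
    {ρ : ℝ} (hρ : ∀ s a, tvDist (T s a) (T' s a) ≤ ρ) :
    tvDist (tripletOcc π T γ μ) (tripletOcc π T' γ μ) ≤ ρ / (1 - γ) := by
  set d := stateOcc π T γ μ with hd
  set d' := stateOcc π T' γ μ with hd'
  set X := ∑ s, ∑ a, ∑ s', |π s a * d s * T s a s' - π s a * d' s * T' s a s'| with hX
  have hdnn (s : S) : 0 ≤ d s := stateOcc_nonneg hπ0 hT0 hγ0 hγ1.le hμ0 s
  have hflow (s' : S) : |d s' - d' s'| ≤
      γ * ∑ s, ∑ a, |π s a * d s * T s a s' - π s a * d' s * T' s a s'| := by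
    rw [hd, hd', stateOcc_eq_add hπ0 hπ hT0 hT hγ0 hγ1 hμ0,
      stateOcc_eq_add hπ0 hπ hT0' hT' hγ0 hγ1 hμ0, ← hd, ← hd', add_sub_add_left_eq_sub,
      ← mul_sub, abs_mul, abs_of_nonneg hγ0, vecMul_policyMatrix, vecMul_policyMatrix]
    simp_rw [← Finset.sum_sub_distrib]
    refine mul_le_mul_of_nonneg_left ((Finset.abs_sum_le_sum_abs _ _).trans ?_) hγ0
    exact Finset.sum_le_sum fun s _ => Finset.abs_sum_le_sum_abs _ _
  have hstate : ∑ s, |d s - d' s| ≤ γ * X := by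
    refine (Finset.sum_le_sum fun s' _ => hflow s').trans_eq ?_
    rw [← Finset.mul_sum, Finset.sum_comm, hX]
    exact congrArg _ (Finset.sum_congr rfl fun s _ => Finset.sum_comm)
  have hsplit : X ≤ ∑ s, ∑ a, ∑ s', π s a * d s * |T s a s' - T' s a s'| +
      ∑ s, ∑ a, ∑ s', π s a * |d s - d' s| * T' s a s' := by
    simp_rw [hX, ← Finset.sum_add_distrib]
    refine Finset.sum_le_sum fun s _ => Finset.sum_le_sum fun a _ =>
      Finset.sum_le_sum fun s' _ => ?_
    calc |π s a * d s * T s a s' - π s a * d' s * T' s a s'|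
        = |π s a * d s * (T s a s' - T' s a s') + π s a * (d s - d' s) * T' s a s'| := by
          congr 1; ring
      _ ≤ _ := (abs_add_le _ _).trans_eq (by
          simp only [abs_mul, abs_of_nonneg (hπ0 s a), abs_of_nonneg (hdnn s),
            abs_of_nonneg (hT0' s a s')])
  have hkernel : ∑ s, ∑ a, ∑ s', π s a * d s * |T s a s' - T' s a s'| ≤ 2 * ρ := by
    calc ∑ s, ∑ a, ∑ s', π s a * d s * |T s a s' - T' s a s'|
        ≤ ∑ s, ∑ a, π s a * d s * (2 * ρ) := by
          refine Finset.sum_le_sum fun s _ => Finset.sum_le_sum fun a _ => ?_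
          rw [← Finset.mul_sum]
          have h := hρ s a
          rw [tvDist] at h
          exact mul_le_mul_of_nonneg_left (by linarith) (mul_nonneg (hπ0 s a) (hdnn s))
      _ = 2 * ρ := by
          simp_rw [← Finset.sum_mul, hπ, one_mul]
          rw [hd, sum_stateOcc hπ0 hπ hT0 hT hγ0 hγ1 hμ0, hμ, one_mul]
  rw [sum_policy_mul_kernel hπ hT' fun s => |d s - d' s|] at hsplit
  have htv : tvDist (tripletOcc π T γ μ) (tripletOcc π T' γ μ) = 1 / 2 * X := by
    simp only [tvDist, tripletOcc, Fintype.sum_prod_type, hX, hd, hd']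
  rw [htv, le_div_iff₀ (sub_pos.2 hγ1)]
  linarith

lemma tripletOcc_nonneg {π : S → A → ℝ} (hπ0 : ∀ s a, 0 ≤ π s a)
    {T : S → A → S → ℝ} (hT0 : ∀ s a s', 0 ≤ T s a s') {γ : ℝ} (hγ0 : 0 ≤ γ) (hγ1 : γ ≤ 1)
    {μ : S → ℝ} (hμ0 : ∀ s, 0 ≤ μ s) (x : S × A × S) : 0 ≤ tripletOcc π T γ μ x :=
  mul_nonneg (mul_nonneg (hπ0 _ _) (stateOcc_nonneg hπ0 hT0 hγ0 hγ1 hμ0 _)) (hT0 _ _ _)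

end Occupancy

/-- An `f`-divergence whose generator is dominated by `α` times that of the total variation
distance is at most `α` times the total variation distance. -/
lemma fDiv_le_mul_tvDist {X : Type*} [Fintype X] {f : ℝ → ℝ} {α : ℝ} (hα : 0 ≤ α)
    (hf : ∀ t : ℝ, 0 ≤ t → f t ≤ α * ((1 / 2) * |t - 1|)) {P Q : X → ℝ} (hP : ∀ x, 0 ≤ P x) :
    fDiv f P Q ≤ α * tvDist P Q := by
  rw [fDiv, tvDist, Finset.mul_sum, Finset.mul_sum]
  refine Finset.sum_le_sum fun x _ => ?_
  split_ifs with hQ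
  · calc Q x * f (P x / Q x) ≤ Q x * (α * (1 / 2 * |P x / Q x - 1|)) :=
          mul_le_mul_of_nonneg_left (hf _ (div_nonneg (hP x) hQ.le)) hQ.le
      _ = α * (1 / 2 * |Q x * (P x / Q x - 1)|) := by rw [abs_mul, abs_of_pos hQ]; ring
      _ = α * (1 / 2 * |P x - Q x|) := by rw [mul_sub, mul_div_cancel₀ _ hQ.ne', mul_one]
  · positivity

theorem fDiv_triplet_occupancy_bound
    {S A : Type*} [Fintype S] [DecidableEq S] [Fintype A] [Nonempty S] [Nonempty A]
    (π : S → A → ℝ) (hπ_nonneg : ∀ s a, 0 ≤ π s a)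
    (hπ_sum : ∀ s, ∑ a, π s a = 1)
    (T T0 : S → A → S → ℝ)
    (hT_nonneg : ∀ s a s', 0 ≤ T s a s') (hT_sum : ∀ s a, ∑ s', T s a s' = 1)
    (hT0_nonneg : ∀ s a s', 0 ≤ T0 s a s') (hT0_sum : ∀ s a, ∑ s', T0 s a s' = 1)
    (γ : ℝ) (hγ0 : 0 < γ) (hγ1 : γ < 1)
    (μ : S → ℝ) (hμ_nonneg : ∀ s, 0 ≤ μ s) (hμ_sum : ∑ s, μ s = 1)
    (ρ' : ℝ) (hρ : ∀ s a, tvDist (T s a) (T0 s a) ≤ ρ')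
    (f : ℝ → ℝ) (α : ℝ) (hα : 0 ≤ α)
    (hf1 : f 1 = 0)
    (hf : ∀ t : ℝ, 0 ≤ t → f t ≤ α * ((1 / 2) * |t - 1|))
    (hac : ∀ x : S × A × S, tripletOcc π T0 γ μ x = 0 → tripletOcc π T γ μ x = 0) :
    fDiv f (tripletOcc π T γ μ) (tripletOcc π T0 γ μ) ≤ α * ρ' / (1 - γ) := by
  rw [mul_div_assoc]
  exact (fDiv_le_mul_tvDist hα hf (tripletOcc_nonneg hπ_nonneg hT_nonneg hγ0.le hγ1.le
    hμ_nonneg)).trans (mul_le_mul_of_nonneg_left (tvDist_tripletOcc_le hπ_nonneg hπ_sum hT_nonneg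
      hT_sum hT0_nonneg hT0_sum hγ0.le hγ1 hμ_nonneg hμ_sum hρ) hα)
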